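/- Let g be a prime number, let w be the ordinary weight function (w(Sum.inl i) = 0 and w(Sum.inr i) = 1 for all i ∈ Fin g), and let G ≤ W be a subgroup containing c, acting transitively on X, and NOT contained in the subgroup {σ ∈ W : σ maps the set {Sum.inl i : i ∈ Fin g} onto itself, or onto the set {Sum.inr i : i ∈ Fin g}} (i.e. G is not contained in Sym({1,…,g}) × ⟨c⟩). Then the weighted permutation representation ρ = (w, G) has maximal angle rank δ_ρ = g, and ρ is geometrically simple. -/

import Mathlib

open scoped BigOperators

namespace PaperAux

/-- The symbol set `X_{2g}`, modeled as `Fin g ⊕ Fin g`. -/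
abbrev X (g : ℕ) := Fin g ⊕ Fin g

/-- The complex conjugation involution `c`, swapping `i` and `ī`. -/
def conjPerm (g : ℕ) : Equiv.Perm (X g) := Equiv.sumComm (Fin g) (Fin g)

/-- The group `W_{2g}`: the centralizer of `c` in `Sym(X_{2g})`. -/
def Wgrp (g : ℕ) : Subgroup (Equiv.Perm (X g)) := Subgroup.centralizer {conjPerm g}

/-- `w` is a weight function. -/
structure IsWeightFn (g : ℕ) (w : X g → ℚ) : Prop where
  nonneg : ∀ x, 0 ≤ w x
  add_one : ∀ i : Fin g, w (Sum.inl i) + w (Sum.inr i) = 1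
  mono : ∀ i j : Fin g, i ≤ j → w (Sum.inl i) ≤ w (Sum.inl j)
  den_dvd : ∀ s : ℚ, s.den ∣ (Finset.univ.filter fun x => w x = s).card

/-- The map `Φ_ρ : X → MonoidAlgebra ℚ G`,
`Φ_ρ(x) = ∑_{σ ∈ G} w(σ⁻¹ x) • (σ : MonoidAlgebra ℚ G)`. -/
noncomputable def Phi {g : ℕ} (w : X g → ℚ) (G : Subgroup (Equiv.Perm (X g))) (x : X g) :
    MonoidAlgebra ℚ G :=
  ∑ᶠ σ : G, w (((σ : Equiv.Perm (X g))⁻¹) x) • MonoidAlgebra.of ℚ G σ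

/-- The sum `∑_{σ ∈ G} σ` in the group algebra. -/
noncomputable def allSum {g : ℕ} (G : Subgroup (Equiv.Perm (X g))) : MonoidAlgebra ℚ G :=
  ∑ᶠ σ : G, MonoidAlgebra.of ℚ G σ

/-- `ρ = (w, G)` is geometrically simple (with base point `x₀ = Sum.inl 0`):
the stabilizer of `Φ_ρ(x₀)` under left multiplication equals the stabilizer of `x₀`. -/
def GeomSimple {g : ℕ} (w : X g → ℚ) (G : Subgroup (Equiv.Perm (X g))) (x₀ : X g) : Prop :=
  ∀ σ : G, MonoidAlgebra.of ℚ G σ * Phi w G x₀ = Phi w G x₀ ↔ (σ : Equiv.Perm (X g)) x₀ = x₀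

/-- The exceptionality identity for a pair of disjoint subsets `T⁺, T⁻ ⊆ Fin g`. -/
def ExcId {g : ℕ} (w : X g → ℚ) (G : Subgroup (Equiv.Perm (X g)))
    (Tp Tm : Finset (Fin g)) : Prop :=
  (∑ i ∈ Tp, Phi w G (Sum.inl i)) - (∑ j ∈ Tm, Phi w G (Sum.inl j))
    = (((Tp.card : ℚ) - (Tm.card : ℚ)) / 2) • allSum G

/-- `ρ = (w, G)` is exceptional. -/
def IsExceptional {g : ℕ} (w : X g → ℚ) (G : Subgroup (Equiv.Perm (X g))) : Prop :=
  ∃ Tp Tm : Finset (Fin g), Disjoint Tp Tm ∧ (Tp ∪ Tm).Nonempty ∧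
    Even (Tp.card + Tm.card) ∧ ExcId w G Tp Tm

/-- The induced map `σ⁺ : Fin g → Fin g` of `σ ∈ W`. -/
def plusFun {g : ℕ} (σ : Equiv.Perm (X g)) (i : Fin g) : Fin g :=
  Sum.elim id id (σ (Sum.inl i))

/-- The level set equivalence relation on `Fin g`. -/
def levelRel {g : ℕ} (G : Subgroup (Equiv.Perm (X g))) (i j : Fin g) : Prop :=
  ∀ γ ∈ G, (∀ k, plusFun γ k = k) →
    ((γ (Sum.inl i) = Sum.inr i) ↔ (γ (Sum.inl j) = Sum.inr j))

/-- The level set partition, as a setoid. -/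
def levelSetoid {g : ℕ} (G : Subgroup (Equiv.Perm (X g))) : Setoid (Fin g) where
  r := levelRel G
  iseqv := ⟨fun _ _ _ _ => Iff.rfl,
            fun h γ hγ h2 => (h γ hγ h2).symm,
            fun h1 h2 γ hγ h3 => (h1 γ hγ h3).trans (h2 γ hγ h3)⟩

/-- `m`: the number of classes of the level set partition. -/
noncomputable def numLevels {g : ℕ} (G : Subgroup (Equiv.Perm (X g))) : ℕ :=
  Nat.card (Quotient (levelSetoid G))

/-- The angle rank `δ_ρ` of a weighted permutation representation. -/
noncomputable def angleRank {g : ℕ} (w : X g → ℚ) (G : Subgroup (Equiv.Perm (X g))) : ℕ :=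
  Module.finrank ℚ (Submodule.span ℚ (Set.range (Phi w G))) - 1

end PaperAux

namespace PaperAux

open Polynomial in
lemma isCoprime_sum_sign_X_pow_sub_one {p : ℕ} (hp : p.Prime) (hp2 : p ≠ 2) (e : ℕ → ℚ)
    (he : ∀ k, e k = 1 ∨ e k = -1) (hne : ∃ k < p, e k ≠ e 0) :
    IsCoprime (∑ k ∈ Finset.range p, C (e k) * Polynomial.X ^ k) (Polynomial.X ^ p - 1 : ℚ[X]) := by
  have : Fact p.Prime := ⟨hp⟩
  set E : ℚ[X] := ∑ k ∈ Finset.range p, C (e k) * Polynomial.X ^ k with hE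
  have hcoeff : ∀ k, E.coeff k = if k < p then e k else 0 := by
    intro k
    simp [hE, finsetSum_coeff, coeff_X_pow]
  have hΦcoeff : ∀ k, (cyclotomic p ℚ).coeff k = if k < p then 1 else 0 := by
    intro k
    simp [cyclotomic_prime, finsetSum_coeff, coeff_X_pow]
  have he0 : ∀ k, e k ≠ 0 := fun k h => by rcases he k with h' | h' <;> norm_num [h'] at h
  rw [← cyclotomic_prime_mul_X_sub_one ℚ p]
  refine IsCoprime.mul_right ?_ ?_
  · refine ((cyclotomic.irreducible_rat hp.pos).coprime_iff_not_dvd.2 ?_).symm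
    rintro ⟨q, hq⟩
    have hE0 : E ≠ 0 := fun h => by
      have := hcoeff 0
      rw [h, if_pos hp.pos] at this
      exact he0 0 (by simpa using this.symm)
    have hq0 : q ≠ 0 := fun h => hE0 (by rw [hq, h, mul_zero])
    have hdeg : E.natDegree ≤ p - 1 := by
      rw [natDegree_le_iff_coeff_eq_zero]
      intro N hN
      rw [hcoeff, if_neg (by omega)]
    have hq1 : q.natDegree = 0 := by
      have h := natDegree_mul (cyclotomic_ne_zero p ℚ) hq0
      rw [← hq, natDegree_cyclotomic, Nat.totient_prime hp] at h
      omega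
    obtain ⟨a, rfl⟩ := natDegree_eq_zero.1 hq1
    have hall : ∀ k < p, e k = a := by
      intro k hk
      have h := hcoeff k
      rw [hq, coeff_mul_C, hΦcoeff, if_pos hk, if_pos hk, one_mul] at h
      exact h.symm
    obtain ⟨k, hk, hne⟩ := hne
    exact hne ((hall k hk).trans (hall 0 hp.pos).symm)
  · rw [← C_1]
    refine ((irreducible_X_sub_C (1 : ℚ)).coprime_iff_not_dvd.2 ?_).symm
    rw [dvd_iff_isRoot]
    intro hroot
    have hm : ∀ k, ∃ m : ℤ, e k = 1 - 2 * m := by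
      intro k
      rcases he k with h | h
      · exact ⟨0, by simp [h]⟩
      · exact ⟨1, by norm_num [h]⟩
    choose m hm using hm
    have hs : (p : ℚ) - 2 * ((∑ k ∈ Finset.range p, m k : ℤ) : ℚ) = 0 := by
      rw [IsRoot.def, hE, eval_finsetSum] at hroot
      simpa [hm, Finset.mul_sum] using hroot
    have hs' : (p : ℤ) - 2 * ∑ k ∈ Finset.range p, m k = 0 := by exact_mod_cast hs
    have := hp.eq_two_or_odd
    omega

lemma eq_zero_of_aeval_eq_zero_of_isCoprime {K M : Type*} [Field K] [AddCommGroup M] [Module K M]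
    (T : Module.End K M) {P Q : Polynomial K} (h : IsCoprime P Q) {f : M}
    (hP : Polynomial.aeval T P f = 0) (hQ : Polynomial.aeval T Q f = 0) : f = 0 := by
  obtain ⟨a, b, hab⟩ := h
  have := congrArg (fun R => Polynomial.aeval T R f) hab
  simpa [hP, hQ] using this.symm

/-- The sign of a symbol: `1` on the `Sum.inl` part and `-1` on the `Sum.inr` part. -/
def sgn {g : ℕ} : X g → ℚ := Sum.elim (fun _ => 1) (fun _ => -1)

@[simp] lemma sgn_inl {g : ℕ} (i : Fin g) : sgn (Sum.inl i : X g) = 1 := rfl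

@[simp] lemma sgn_inr {g : ℕ} (i : Fin g) : sgn (Sum.inr i : X g) = -1 := rfl

lemma sgn_eq_or {g : ℕ} (x : X g) : sgn x = 1 ∨ sgn x = -1 := by
  rcases x with i | i <;> simp

@[simp] lemma conjPerm_inl {g : ℕ} (i : Fin g) : conjPerm g (Sum.inl i) = Sum.inr i := rfl

@[simp] lemma conjPerm_inr {g : ℕ} (i : Fin g) : conjPerm g (Sum.inr i) = Sum.inl i := rfl

@[simp] lemma conjPerm_conjPerm {g : ℕ} (x : X g) : conjPerm g (conjPerm g x) = x := by
  rcases x with i | i <;> simp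

lemma conjPerm_ne {g : ℕ} (x : X g) : conjPerm g x ≠ x := by
  rcases x with i | i <;> simp

@[simp] lemma sgn_conjPerm {g : ℕ} (x : X g) : sgn (conjPerm g x) = - sgn x := by
  rcases x with i | i <;> simp

lemma apply_conjPerm {g : ℕ} {σ : Equiv.Perm (X g)} (hσ : σ ∈ Wgrp g) (x : X g) :
    σ (conjPerm g x) = conjPerm g (σ x) := by
  have h := Subgroup.mem_centralizer_iff.1 hσ (conjPerm g) rfl
  exact (DFunLike.congr_fun h x).symm

lemma exists_orderOf_eq_prime {g : ℕ} (hgp : g.Prime) (G : Subgroup (Equiv.Perm (X g)))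
    (htrans : ∀ x y : X g, ∃ σ ∈ G, σ x = y) : ∃ τ ∈ G, orderOf τ = g := by
  have : Fact g.Prime := ⟨hgp⟩
  have : MulAction.IsPretransitive G (X g) :=
    ⟨fun x y => let ⟨σ, hσ, h⟩ := htrans x y; ⟨⟨σ, hσ⟩, h⟩⟩
  have hdvd : g ∣ Nat.card G := by
    have h := (MulAction.stabilizer G (Sum.inl ⟨0, hgp.pos⟩ : X g)).index_dvd_card
    rw [MulAction.index_stabilizer_of_transitive] at h
    refine Dvd.dvd.trans ?_ h
    simp [← two_mul]
  obtain ⟨τ, hτ⟩ := exists_prime_orderOf_dvd_card' (G := G) g hdvd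
  exact ⟨τ, τ.2, (Subgroup.orderOf_coe τ).trans hτ⟩

/-- A permutation of odd prime order `g` commuting with `c` splits the symbols into an orbit of
size `g` and its conjugate. -/
lemma exists_bijective_orbit {g : ℕ} (hgp : g.Prime) (hg2 : g ≠ 2) {τ : Equiv.Perm (X g)}
    (hτW : τ ∈ Wgrp g) (hτ : orderOf τ = g) :
    ∃ x₀ : X g, Function.Bijective (Sum.elim (fun k : Fin g => (τ ^ (k : ℕ)) x₀)
      (fun k : Fin g => conjPerm g ((τ ^ (k : ℕ)) x₀)) : Fin g ⊕ Fin g → X g) := by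
  have : Fact g.Prime := ⟨hgp⟩
  have hpow : τ ^ g = 1 := orderOf_dvd_iff_pow_eq_one.1 hτ.dvd
  obtain ⟨x₀, hx₀⟩ : ∃ x, τ x ≠ x := by
    by_contra! h
    have : τ = 1 := Equiv.ext h
    rw [this, orderOf_one] at hτ
    exact hgp.one_lt.ne hτ
  have hmin : Function.minimalPeriod τ x₀ = g := by
    refine Function.minimalPeriod_eq_prime ?_ hx₀
    rw [Function.IsPeriodicPt, Function.IsFixedPt, Equiv.Perm.iterate_eq_pow, hpow]
    rfl
  have hinj : ∀ j k : Fin g, (τ ^ (j : ℕ)) x₀ = (τ ^ (k : ℕ)) x₀ → j = k := by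
    intro j k h
    refine Fin.ext (Function.iterate_injOn_Iio_minimalPeriod (f := τ) (x := x₀) ?_ ?_ ?_)
    · rw [hmin]; exact j.2
    · rw [hmin]; exact k.2
    · simpa only [Equiv.Perm.iterate_eq_pow] using h
  have hfix : ∀ n : ℕ, (τ ^ n) x₀ = x₀ → g ∣ n := by
    intro n h
    rw [← hmin]
    refine Function.IsPeriodicPt.minimalPeriod_dvd ?_
    rwa [Function.IsPeriodicPt, Function.IsFixedPt, Equiv.Perm.iterate_eq_pow]
  have hconj : ∀ n : ℕ, (τ ^ n) x₀ ≠ conjPerm g x₀ := by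
    intro n h
    have h2 : (τ ^ (2 * n)) x₀ = x₀ := by
      rw [two_mul, pow_add, Equiv.Perm.mul_apply, h, apply_conjPerm (pow_mem hτW n), h,
        conjPerm_conjPerm]
    have hn : g ∣ n := by
      refine (Nat.Coprime.dvd_mul_left ?_).1 (hfix _ h2)
      exact (Nat.coprime_primes hgp Nat.prime_two).2 hg2
    obtain ⟨m, rfl⟩ := hn
    rw [pow_mul, hpow, one_pow] at h
    exact conjPerm_ne x₀ h.symm
  have hcross : ∀ j k : Fin g, (τ ^ (j : ℕ)) x₀ ≠ conjPerm g ((τ ^ (k : ℕ)) x₀) := by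
    intro j k h
    refine hconj (g - k + j) ?_
    rw [pow_add, Equiv.Perm.mul_apply, h, apply_conjPerm (pow_mem hτW _),
      ← Equiv.Perm.mul_apply (τ ^ _), ← pow_add, Nat.sub_add_cancel k.2.le, hpow,
      Equiv.Perm.one_apply]
  refine ⟨x₀, Finite.injective_iff_bijective.1 ?_⟩
  rintro (j | j) (k | k) h
  · exact congrArg _ (hinj j k h)
  · exact (hcross j k h).elim
  · exact (hcross k j h.symm).elim
  · exact congrArg _ (hinj j k ((conjPerm g).injective h))

lemma exists_sgn_ne {g : ℕ} {G : Subgroup (Equiv.Perm (X g))}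
    (hnot : ¬ ∀ σ ∈ G, (⇑σ '' Set.range (Sum.inl : Fin g → X g) = Set.range Sum.inl ∨
        ⇑σ '' Set.range (Sum.inl : Fin g → X g) = Set.range Sum.inr)) :
    ∃ σ ∈ G, ∃ i j : Fin g, sgn (σ (Sum.inl i)) ≠ sgn (σ (Sum.inl j)) := by
  by_contra! h
  refine hnot fun σ hσ => ?_
  have hl : (Set.range (Sum.inl : Fin g → X g)).ncard = g := by
    rw [← Set.image_univ, Set.ncard_image_of_injective _ Sum.inl_injective]; simp
  have hr : (Set.range (Sum.inr : Fin g → X g)).ncard = g := by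
    rw [← Set.image_univ, Set.ncard_image_of_injective _ Sum.inr_injective]; simp
  have hσl : (σ '' Set.range (Sum.inl : Fin g → X g)).ncard = g := by
    rw [Set.ncard_image_of_injective _ σ.injective, hl]
  by_cases hall : ∀ i : Fin g, sgn (σ (Sum.inl i)) = 1
  · left
    refine Set.eq_of_subset_of_ncard_le ?_ (by rw [hl, hσl])
    rintro _ ⟨_, ⟨i, rfl⟩, rfl⟩
    have hi := hall i
    rcases hx : σ (Sum.inl i) with k | k
    · exact ⟨k, rfl⟩
    · rw [hx] at hi; norm_num at hi
  · right
    push Not at hall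
    obtain ⟨i₀, hi₀⟩ := hall
    refine Set.eq_of_subset_of_ncard_le ?_ (by rw [hr, hσl])
    rintro _ ⟨_, ⟨i, rfl⟩, rfl⟩
    have hi := h σ hσ i i₀
    rcases hx : σ (Sum.inl i) with k | k
    · rw [hx] at hi; exact (hi₀ hi.symm).elim
    · exact ⟨k, rfl⟩

open Polynomial in
/-- An odd function on the symbols which is orthogonal to all `G`-translates of the sign function
vanishes (odd prime case). -/
lemma odd_eq_zero_of_ne_two {g : ℕ} (hgp : g.Prime) (hg2 : g ≠ 2)
    {G : Subgroup (Equiv.Perm (X g))} (hGW : G ≤ Wgrp g)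
    (htrans : ∀ x y : X g, ∃ σ ∈ G, σ x = y)
    (hne : ∃ σ ∈ G, ∃ i j : Fin g, sgn (σ (Sum.inl i)) ≠ sgn (σ (Sum.inl j)))
    (f : X g → ℚ) (hodd : ∀ x, f (conjPerm g x) = - f x)
    (horth : ∀ σ ∈ G, ∑ y, sgn (σ y) * f y = 0) : f = 0 := by
  obtain ⟨τ, hτG, hτ⟩ := exists_orderOf_eq_prime hgp G htrans
  have hpow : τ ^ g = 1 := orderOf_dvd_iff_pow_eq_one.1 hτ.dvd
  obtain ⟨x₀, hbij⟩ := exists_bijective_orbit hgp hg2 (hGW hτG) hτ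
  have hsum : ∀ h : X g → ℚ, (∀ x, h (conjPerm g x) = h x) →
      ∑ y, h y = 2 * ∑ k : Fin g, h ((τ ^ (k : ℕ)) x₀) := by
    intro h hh
    rw [← hbij.sum_comp, Fintype.sum_sum_type]
    simp [hh, two_mul]
  obtain ⟨σ, hσ, k₀, hk₀, hek⟩ :
      ∃ σ ∈ G, ∃ k < g, sgn (σ ((τ ^ k) x₀)) ≠ sgn (σ ((τ ^ 0) x₀)) := by
    by_contra! hcon
    have key : ∀ σ ∈ G, ∀ y : X g, sgn (σ y) * sgn x₀ = sgn (σ x₀) * sgn y := by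
      intro σ hσ y
      obtain ⟨k | k, rfl⟩ := hbij.surjective y
      · have h1 := hcon σ hσ k k.2
        have h2 := hcon 1 G.one_mem k k.2
        simp only [pow_zero, Equiv.Perm.one_apply] at h1 h2
        simp [h1, h2]
      · have h1 := hcon σ hσ k k.2
        have h2 := hcon 1 G.one_mem k k.2
        simp only [pow_zero, Equiv.Perm.one_apply] at h1 h2
        simp [h1, h2, apply_conjPerm (hGW hσ)]
    obtain ⟨σ, hσ, i, j, hij⟩ := hne
    have hi := key σ hσ (Sum.inl i)
    have hj := key σ hσ (Sum.inl j)
    rw [sgn_inl] at hi hj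
    refine hij (mul_right_cancel₀ (b := sgn x₀) ?_ (hi.trans hj.symm))
    rcases sgn_eq_or x₀ with h | h <;> norm_num [h]
  let T : Module.End ℚ (X g → ℚ) := LinearMap.funLeft ℚ ℚ τ
  have hT : ∀ (k : ℕ) (y : X g), (T ^ k) f y = f ((τ ^ k) y) := by
    intro k
    induction k with
    | zero => intro y; simp
    | succ k ih =>
      intro y
      rw [pow_succ', Module.End.mul_apply]
      change (T ^ k) f (τ y) = _
      rw [ih, pow_succ, Equiv.Perm.mul_apply]
  refine eq_zero_of_aeval_eq_zero_of_isCoprime T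
    (isCoprime_sum_sign_X_pow_sub_one hgp hg2 (fun k => sgn (σ ((τ ^ k) x₀)))
      (fun k => sgn_eq_or _) ⟨k₀, hk₀, hek⟩) ?_ ?_
  · have hval : ∀ y, aeval T (∑ k ∈ Finset.range g, C (sgn (σ ((τ ^ k) x₀))) * Polynomial.X ^ k) f y
        = ∑ k : Fin g, sgn (σ ((τ ^ (k : ℕ)) x₀)) * f ((τ ^ (k : ℕ)) y) := by
      intro y
      rw [← Finset.sum_range (fun k => sgn (σ ((τ ^ k) x₀)) * f ((τ ^ k) y))]
      simp [map_sum, LinearMap.sum_apply, Finset.sum_apply, hT, Module.End.mul_apply,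
        Module.algebraMap_end_apply]
    have horbit : ∀ j : ℕ,
        ∑ k : Fin g, sgn (σ ((τ ^ (k : ℕ)) x₀)) * f ((τ ^ (k : ℕ)) ((τ ^ j) x₀)) = 0 := by
      intro j
      have hτj : τ ^ j ∈ G := pow_mem hτG j
      have h1 := hsum (fun y => sgn (σ y) * f ((τ ^ j) y)) (by
        intro y
        simp [apply_conjPerm (hGW hσ), apply_conjPerm (hGW hτj), hodd])
      have h2 : ∑ y, sgn (σ y) * f ((τ ^ j) y) = 0 := by
        have h3 := horth (σ * (τ ^ j)⁻¹) (G.mul_mem hσ (G.inv_mem hτj))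
        rw [← Equiv.sum_comp (τ ^ j)] at h3
        simpa using h3
      rw [h2] at h1
      have h4 : ∑ k : Fin g, sgn (σ ((τ ^ (k : ℕ)) x₀)) * f ((τ ^ j) ((τ ^ (k : ℕ)) x₀)) = 0 := by
        linarith
      rw [← h4]
      refine Finset.sum_congr rfl fun k _ => ?_
      rw [← Equiv.Perm.mul_apply (τ ^ _), ← Equiv.Perm.mul_apply (τ ^ _), pow_mul_comm]
    funext y
    rw [hval]
    obtain ⟨j | j, rfl⟩ := hbij.surjective y
    · exact horbit j
    · have h := horbit j
      simp only [Sum.elim_inr, Pi.zero_apply]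
      simp only [fun k : Fin g => apply_conjPerm (hGW (pow_mem hτG (k : ℕ))), hodd, mul_neg,
        Finset.sum_neg_distrib, h, neg_zero]
  · funext y
    simp [hT, hpow]

lemma odd_eq_zero_of_two {G : Subgroup (Equiv.Perm (X 2))} (hGW : G ≤ Wgrp 2)
    (hne : ∃ σ ∈ G, ∃ i j : Fin 2, sgn (σ (Sum.inl i)) ≠ sgn (σ (Sum.inl j)))
    (f : X 2 → ℚ) (hodd : ∀ x, f (conjPerm 2 x) = - f x)
    (horth : ∀ σ ∈ G, ∑ y, sgn (σ y) * f y = 0) : f = 0 := by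
  have hf : ∀ i, f (Sum.inr i) = - f (Sum.inl i) := fun i => hodd (Sum.inl i)
  have hsum : ∀ σ ∈ G, sgn (σ (Sum.inl 0)) * f (Sum.inl 0)
      + sgn (σ (Sum.inl 1)) * f (Sum.inl 1) = 0 := by
    intro σ hσ
    have hs : ∀ i, sgn (σ (Sum.inr i)) = - sgn (σ (Sum.inl i)) := fun i => by
      rw [← conjPerm_inl, apply_conjPerm (hGW hσ), sgn_conjPerm]
    have h := horth σ hσ
    simp only [Fintype.sum_sum_type, Fin.sum_univ_two, hs, hf] at h
    linarith
  obtain ⟨σ, hσ, i, j, hij⟩ := hne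
  have h01 : sgn (σ (Sum.inl 0)) ≠ sgn (σ (Sum.inl 1)) := by
    intro h
    fin_cases i <;> fin_cases j <;> simp_all
  have h1 := hsum 1 G.one_mem
  have h2 := hsum σ hσ
  simp only [Equiv.Perm.one_apply, sgn_inl] at h1
  have h3 : f (Sum.inl 0) = 0 ∧ f (Sum.inl 1) = 0 := by
    rcases sgn_eq_or (σ (Sum.inl 0)) with ha | ha <;>
    rcases sgn_eq_or (σ (Sum.inl 1)) with hb | hb <;> rw [ha, hb] at h01 h2 <;>
    first
    | exact (h01 rfl).elim
    | constructor <;> linarith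
  have h4 : ∀ i, f (Sum.inl i) = 0 := Fin.forall_fin_two.2 h3
  funext x
  rcases x with i | i
  · exact h4 i
  · simp [hf, h4]

/-- The ordinary weight function. -/
abbrev ordWt (g : ℕ) : X g → ℚ := Sum.elim (fun _ => (0 : ℚ)) (fun _ => (1 : ℚ))

lemma ordWt_eq {g : ℕ} (x : X g) : ordWt g x = (1 - sgn x) / 2 := by
  rcases x with i | i <;> norm_num

lemma coeff_Phi {g : ℕ} (w : X g → ℚ) (G : Subgroup (Equiv.Perm (X g))) (x : X g) (σ : G) :
    (Phi w G x).coeff σ = w ((σ : Equiv.Perm (X g))⁻¹ x) := by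
  classical
  rw [Phi, finsum_eq_sum_of_fintype]
  simp [Finsupp.single_apply]

lemma coeff_allSum {g : ℕ} (G : Subgroup (Equiv.Perm (X g))) (σ : G) :
    (allSum G).coeff σ = 1 := by
  classical
  rw [allSum, finsum_eq_sum_of_fintype]
  simp [Finsupp.single_apply]

lemma of_mul_Phi {g : ℕ} (w : X g → ℚ) (G : Subgroup (Equiv.Perm (X g))) (x : X g) (σ : G) :
    MonoidAlgebra.of ℚ G σ * Phi w G x = Phi w G ((σ : Equiv.Perm (X g)) x) := by
  ext τ
  simp [coeff_Phi, MonoidAlgebra.of_apply, MonoidAlgebra.coeff_single_mul_apply]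

lemma Phi_ordWt_inl_add_inr {g : ℕ} {G : Subgroup (Equiv.Perm (X g))} (hGW : G ≤ Wgrp g)
    (i : Fin g) : Phi (ordWt g) G (Sum.inl i) + Phi (ordWt g) G (Sum.inr i) = allSum G := by
  ext τ
  rw [MonoidAlgebra.coeff_add, Finsupp.add_apply, coeff_Phi, coeff_Phi, coeff_allSum, ordWt_eq,
    ordWt_eq, ← conjPerm_inl, apply_conjPerm (inv_mem (hGW τ.2)), sgn_conjPerm]
  ring

lemma sgn_eq_of_Phi_eq {g : ℕ} {G : Subgroup (Equiv.Perm (X g))} {x y : X g}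
    (h : Phi (ordWt g) G x = Phi (ordWt g) G y) {σ : Equiv.Perm (X g)} (hσ : σ ∈ G) :
    sgn (σ x) = sgn (σ y) := by
  have h1 := congrArg (fun v => v.coeff (⟨σ, hσ⟩⁻¹ : G)) h
  simp only [coeff_Phi, ordWt_eq, InvMemClass.coe_inv, inv_inv] at h1
  linarith

/-- The family consisting of `∑ σ` together with the `Φ(i)` for `i ∈ Fin g`. -/
noncomputable def phiFamily {g : ℕ} (G : Subgroup (Equiv.Perm (X g))) :
    Fin g ⊕ Unit → MonoidAlgebra ℚ G :=
  Sum.elim (fun i => Phi (ordWt g) G (Sum.inl i)) (fun _ => allSum G)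

lemma span_range_phiFamily {g : ℕ} (hg : 0 < g) {G : Subgroup (Equiv.Perm (X g))}
    (hGW : G ≤ Wgrp g) :
    Submodule.span ℚ (Set.range (Phi (ordWt g) G))
      = Submodule.span ℚ (Set.range (phiFamily G)) := by
  apply le_antisymm <;> rw [Submodule.span_le]
  · have hl : ∀ i, Phi (ordWt g) G (Sum.inl i) ∈ Submodule.span ℚ (Set.range (phiFamily G)) :=
      fun i => Submodule.subset_span ⟨Sum.inl i, rfl⟩
    rintro _ ⟨i | i, rfl⟩
    · exact hl i
    · rw [← add_sub_cancel_left (Phi (ordWt g) G (Sum.inl i)) (Phi (ordWt g) G (Sum.inr i)),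
        Phi_ordWt_inl_add_inr hGW]
      exact sub_mem (Submodule.subset_span ⟨Sum.inr (), rfl⟩) (hl i)
  · rintro _ ⟨i | i, rfl⟩
    · exact Submodule.subset_span ⟨Sum.inl i, rfl⟩
    · change allSum G ∈ _
      rw [← Phi_ordWt_inl_add_inr hGW ⟨0, hg⟩]
      exact add_mem (Submodule.subset_span ⟨_, rfl⟩) (Submodule.subset_span ⟨_, rfl⟩)

lemma linearIndependent_phiFamily {g : ℕ} {G : Subgroup (Equiv.Perm (X g))} (hGW : G ≤ Wgrp g)
    (hc : conjPerm g ∈ G)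
    (hzero : ∀ f : X g → ℚ, (∀ x, f (conjPerm g x) = - f x) →
      (∀ σ ∈ G, ∑ y, sgn (σ y) * f y = 0) → f = 0) :
    LinearIndependent ℚ (phiFamily G) := by
  rw [Fintype.linearIndependent_iff]
  intro a ha
  have hcoeff : ∀ σ ∈ G, ∑ i : Fin g, a (Sum.inl i) * ((1 - sgn (σ (Sum.inl i))) / 2)
      + a (Sum.inr ()) = 0 := by
    intro σ hσ
    have h := congrArg (fun v => v.coeff (⟨σ, hσ⟩⁻¹ : G)) ha
    simpa [phiFamily, Fintype.sum_sum_type, MonoidAlgebra.coeff_sum, coeff_Phi, coeff_allSum,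
      ordWt_eq, -Sum.elim_lam_const_lam_const] using h
  have hl : ∀ σ ∈ G, ∑ i : Fin g, a (Sum.inl i) * sgn (σ (Sum.inl i)) = 0 := by
    intro σ hσ
    have h1 := hcoeff σ hσ
    have h2 := hcoeff (conjPerm g * σ) (G.mul_mem hc hσ)
    simp only [Equiv.Perm.mul_apply, sgn_conjPerm] at h2
    have h3 : ∑ i : Fin g, a (Sum.inl i) * sgn (σ (Sum.inl i))
        = ∑ i : Fin g, a (Sum.inl i) * ((1 - -sgn (σ (Sum.inl i))) / 2)
          - ∑ i : Fin g, a (Sum.inl i) * ((1 - sgn (σ (Sum.inl i))) / 2) := by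
      rw [← Finset.sum_sub_distrib]
      exact Finset.sum_congr rfl fun i _ => by ring
    linarith
  have hf := hzero (Sum.elim (fun i => a (Sum.inl i)) (fun i => - a (Sum.inl i)))
    (by rintro (i | i) <;> simp)
    (by
      intro σ hσ
      have hs : ∀ i, sgn (σ (Sum.inr i)) = - sgn (σ (Sum.inl i)) := fun i => by
        rw [← conjPerm_inl, apply_conjPerm (hGW hσ), sgn_conjPerm]
      have h := hl σ hσ
      simp only [mul_comm (a _)] at h
      simp [Fintype.sum_sum_type, hs, h])
  have hinl : ∀ i, a (Sum.inl i) = 0 := fun i => congrFun hf (Sum.inl i)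
  rintro (i | ⟨⟩)
  · exact hinl i
  · simpa [hinl] using hcoeff 1 G.one_mem

lemma Phi_ordWt_injective {g : ℕ} {G : Subgroup (Equiv.Perm (X g))} (hGW : G ≤ Wgrp g)
    (hzero : ∀ f : X g → ℚ, (∀ x, f (conjPerm g x) = - f x) →
      (∀ σ ∈ G, ∑ y, sgn (σ y) * f y = 0) → f = 0) :
    Function.Injective (Phi (ordWt g) G) := by
  intro x y hxy
  have hswap : ∀ u v : X g, conjPerm g u = v ↔ u = conjPerm g v := fun u v =>
    ⟨fun h => by rw [← h, conjPerm_conjPerm], fun h => by rw [h, conjPerm_conjPerm]⟩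
  have hf := hzero (fun z => (if z = x then 1 else 0) - (if z = conjPerm g x then 1 else 0)
      - (if z = y then 1 else 0) + (if z = conjPerm g y then 1 else 0))
    (by
      intro z
      simp only [hswap, conjPerm_conjPerm]
      ring)
    (by
      intro σ hσ
      simp [mul_add, mul_sub, Finset.sum_add_distrib, apply_conjPerm (hGW hσ),
        sgn_eq_of_Phi_eq hxy hσ])
  by_contra hne
  have h := congrFun hf x
  simp only [if_true, if_neg (conjPerm_ne x).symm, if_neg hne, Pi.zero_apply] at h
  split_ifs at h <;> norm_num at h

end PaperAux

open PaperAux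

/-- for `g` prime and an ordinary weight function, if `G` is not contained in
`Sym({1,…,g}) × ⟨c⟩` then `ρ` has maximal angle rank `g` and is geometrically simple. -/
theorem ordinary_prime_max_angle_rank {g : ℕ} (hgp : Nat.Prime g)
    (G : Subgroup (Equiv.Perm (X g))) (hGW : G ≤ Wgrp g) (hc : conjPerm g ∈ G)
    (htrans : ∀ x y : X g, ∃ σ ∈ G, σ x = y)
    (hnot : ¬ ∀ σ ∈ G, (⇑σ '' Set.range (Sum.inl : Fin g → X g) = Set.range Sum.inl ∨
        ⇑σ '' Set.range (Sum.inl : Fin g → X g) = Set.range Sum.inr)) :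
    angleRank (Sum.elim (fun _ => (0 : ℚ)) (fun _ => (1 : ℚ))) G = g ∧
      GeomSimple (Sum.elim (fun _ => (0 : ℚ)) (fun _ => (1 : ℚ))) G (Sum.inl ⟨0, hgp.pos⟩) := by
  have hne := exists_sgn_ne hnot
  have hzero : ∀ f : X g → ℚ, (∀ x, f (conjPerm g x) = - f x) →
      (∀ σ ∈ G, ∑ y, sgn (σ y) * f y = 0) → f = 0 := by
    intro f hodd horth
    by_cases hg2 : g = 2
    · subst hg2
      exact odd_eq_zero_of_two hGW hne f hodd horth
    · exact odd_eq_zero_of_ne_two hgp hg2 hGW htrans hne f hodd horth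
  constructor
  · change angleRank (ordWt g) G = g
    rw [angleRank, span_range_phiFamily hgp.pos hGW,
      finrank_span_eq_card (linearIndependent_phiFamily hGW hc hzero)]
    simp
  · intro σ
    change _ * Phi (ordWt g) G _ = Phi (ordWt g) G _ ↔ _
    rw [of_mul_Phi]
    exact (Phi_ordWt_injective hGW hzero).eq_iff
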